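/- arXiv:1810.12258 — 2 statements merged into one kernel-verified Lean document; each statement's English description precedes it below -/
import Mathlib

section
/- For positive integers p and q, define f_{p,q}(x) = ∑_{i=0}^{min(p,q)} 4^i C(p,i) C(q,i) x^i (x+1)^{p+q-2i}. Then f_{p,q} is real-rooted and f_{p,q} interlaces f_{p,q+1}: if a₁ ≥ a₂ ≥ ⋯ are the roots of f_{p,q+1} and b₁ ≥ b₂ ≥ ⋯ are the roots of f_{p,q}, then a₁ ≥ b₁ ≥ a₂ ≥ b₂ ≥ ⋯. -/
open Polynomial Finset

/-- The h*-polynomial `f_{p,q}` of the polytope `B_{K_{p,q}}`. -/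
noncomputable def fKpq (p q : ℕ) : Polynomial ℝ :=
  ∑ i ∈ Finset.range (min p q + 1),
    C ((4 : ℝ) ^ i * p.choose i * q.choose i) * X ^ i * (X + 1) ^ (p + q - 2 * i)

theorem fKpq_eq_sum_range (p q : ℕ) :
    fKpq p q = ∑ i ∈ Finset.range (p + 1),
      C ((4 : ℝ) ^ i * p.choose i * q.choose i) * X ^ i * (X + 1) ^ (p + q - 2 * i) := by
  rw [fKpq]
  refine Finset.sum_subset (fun i => by simp only [Finset.mem_range]; omega) fun i hi hi' => ?_
  simp only [Finset.mem_range] at hi hi'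
  rw [Nat.choose_eq_zero_of_lt (show q < i by omega)]
  simp

theorem fKpq_zero_right (p : ℕ) : fKpq p 0 = (X + 1) ^ p := by
  simp [fKpq]

theorem fKpq_derivative_recurrence (p q : ℕ) :
    C ((q : ℝ) + 1) * (X + 1) * fKpq p (q + 1) =
      X * (1 - X) * (X + 1) * derivative (fKpq p q) +
        ((C ((q : ℝ) + 1) * (X + 1) + C ((p : ℝ) + q) * X) * (X + 1) +
          C (2 * ((p : ℝ) - q)) * X) * fKpq p q := by
  set B : ℕ → ℝ[X] := fun i => C ((4 : ℝ) ^ (i + 1) * (p - i) * p.choose i * q.choose i) *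
    X ^ (i + 1) * (X + 1) ^ (p + q - 2 * i) with hB
  set A : ℕ → ℝ[X] := fun i => C ((4 : ℝ) ^ i * (i + q + 1) * p.choose i * q.choose i) *
    X ^ i * (X + 1) ^ (p + q - 2 * i) * (X + 1) ^ 2 with hA
  set T : ℕ → ℝ[X] := fun i => C ((4 : ℝ) ^ i * p.choose i * (q + 1).choose i) * X ^ i *
    (X + 1) ^ (p + (q + 1) - 2 * i) with hT
  have hR : X * (1 - X) * (X + 1) * derivative (fKpq p q) +
        ((C ((q : ℝ) + 1) * (X + 1) + C ((p : ℝ) + q) * X) * (X + 1) +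
          C (2 * ((p : ℝ) - q)) * X) * fKpq p q = ∑ i ∈ Finset.range (p + 1), (A i + B i) := by
    rw [fKpq_eq_sum_range, derivative_sum, Finset.mul_sum, Finset.mul_sum,
      ← Finset.sum_add_distrib]
    refine Finset.sum_congr rfl fun i hi => ?_
    simp only [Finset.mem_range] at hi
    rcases lt_or_ge q i with h | h
    · simp [hA, hB, Nat.choose_eq_zero_of_lt h]
    obtain ⟨a, rfl⟩ := Nat.exists_eq_add_of_le (show i ≤ p by omega)
    obtain ⟨b, rfl⟩ := Nat.exists_eq_add_of_le h
    have e : i + a + (i + b) - 2 * i = a + b := by omega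
    simp only [hA, hB, e]
    set K := (4 : ℝ) ^ i * (i + a).choose i * (i + b).choose i with hK
    have e1 : (4 : ℝ) ^ (i + 1) * (((i + a : ℕ) : ℝ) - i) * (i + a).choose i * (i + b).choose i
        = 4 * a * K := by push_cast; ring
    have e2 : (4 : ℝ) ^ i * (i + ((i + b : ℕ) : ℝ) + 1) * (i + a).choose i * (i + b).choose i
        = (2 * i + b + 1) * K := by push_cast; ring
    rw [e1, e2]
    have d1 : X * derivative (X ^ i : ℝ[X]) = C (i : ℝ) * X ^ i := by
      cases i with
      | zero => simp
      | succ i => simp; ring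
    have d2 : (X + 1) * derivative ((X + 1 : ℝ[X]) ^ (a + b)) =
        C ((a : ℝ) + b) * (X + 1) ^ (a + b) := by
      generalize hn : a + b = n
      have : (a : ℝ) + b = n := by rw [← hn]; push_cast; ring
      rw [this]
      cases n with
      | zero => simp
      | succ n => simp [derivative_pow]; ring
    rw [derivative_mul, derivative_C_mul]
    simp only [map_mul, map_add, map_sub, C_1, Nat.cast_add] at d1 d2 ⊢
    have h2 : (C 2 : ℝ[X]) = 2 := rfl
    have h4 : (C 4 : ℝ[X]) = 4 := rfl
    rw [h2, h4]
    linear_combination (1 - X) * (X + 1) * C K * (X + 1) ^ (a + b) * d1 +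
      X * (1 - X) * C K * X ^ i * d2
  have hL0 : C ((q : ℝ) + 1) * (X + 1) * T 0 = A 0 := by
    simp only [hT, hA]
    simp
    ring
  have hL : ∀ i < p, C ((q : ℝ) + 1) * (X + 1) * T (i + 1) = A (i + 1) + B i := by
    intro i hi
    rcases lt_or_ge q i with h | h
    · simp [hA, hB, hT, Nat.choose_eq_zero_of_lt h,
        Nat.choose_eq_zero_of_lt (show q < i + 1 by omega),
        Nat.choose_eq_zero_of_lt (show q + 1 < i + 1 by omega)]
    obtain ⟨a, rfl⟩ := Nat.exists_eq_add_of_le (show i + 1 ≤ p by omega)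
    obtain ⟨b, rfl⟩ := Nat.exists_eq_add_of_le h
    have c1 : ((i + 1 + a).choose (i + 1) : ℝ) * (i + 1) = (i + 1 + a).choose i * (a + 1) := by
      have := Nat.choose_succ_right_eq (i + 1 + a) i
      rw [show i + 1 + a - i = a + 1 by omega] at this
      exact_mod_cast this
    have c2 : ((i + b).choose (i + 1) : ℝ) * (i + 1) = (i + b).choose i * b := by
      have := Nat.choose_succ_right_eq (i + b) i
      rw [show i + b - i = b by omega] at this
      exact_mod_cast this
    have c3 : ((i + b + 1).choose (i + 1) : ℝ) = (i + b).choose i + (i + b).choose (i + 1) := by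
      exact_mod_cast Nat.choose_succ_succ (i + b) i
    have hA' : A (i + 1) = C ((4 : ℝ) ^ (i + 1) * (2 * i + b + 2) * (i + 1 + a).choose (i + 1) *
        (i + b).choose (i + 1)) * X ^ (i + 1) * (X + 1) ^ (a + b + 1) := by
      simp only [hA]
      rcases Nat.eq_zero_or_pos b with rfl | hb
      · simp
      · rw [show a + b + 1 = (i + 1 + a + (i + b) - 2 * (i + 1)) + 2 by omega,
          pow_add (X + 1 : ℝ[X]), ← mul_assoc]
        congr 5
        push_cast
        ring
    have hc : ((i + b : ℕ) + 1 : ℝ) * ((4 : ℝ) ^ (i + 1) * (i + 1 + a).choose (i + 1) *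
        (i + b + 1).choose (i + 1)) =
        (4 : ℝ) ^ (i + 1) * (2 * i + b + 2) * (i + 1 + a).choose (i + 1) * (i + b).choose (i + 1) +
        (4 : ℝ) ^ (i + 1) * ((i + 1 + a : ℕ) - i) * (i + 1 + a).choose i * (i + b).choose i := by
      rw [c3]
      push_cast
      linear_combination (4 : ℝ) ^ (i + 1) * ((i + b).choose i * c1 -
        ((i + 1 + a).choose (i + 1) : ℝ) * c2)
    rw [hA']
    simp only [hT, hB]
    rw [show i + 1 + a + (i + b + 1) - 2 * (i + 1) = a + b by omega,
      show i + 1 + a + (i + b) - 2 * i = a + b + 1 by omega]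
    have hc' := congrArg (C : ℝ → ℝ[X]) hc
    rw [C_add, C_mul] at hc'
    linear_combination X ^ (i + 1) * (X + 1) ^ (a + b + 1) * hc'
  rw [hR, fKpq_eq_sum_range, Finset.mul_sum, Finset.sum_add_distrib, Finset.sum_range_succ',
    Finset.sum_range_succ' A, Finset.sum_range_succ B]
  have hBp : B p = 0 := by simp [hB]
  rw [hBp]
  have := Finset.sum_congr rfl fun i hi => hL i (Finset.mem_range.1 hi)
  rw [Finset.sum_add_distrib] at this
  rw [this, hL0]
  ring

theorem exists_multiset_prod_eq_mul_exp_arctan (A : Multiset ℝ) (c s : ℝ) :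
    ∃ r : ℝ, 0 < r ∧ (A.map fun a => (1 - Complex.I * (s * (c - a) : ℝ))).prod =
      r * Complex.exp (-Complex.I * ((A.map fun a => Real.arctan (s * (c - a))).sum : ℝ)) := by
  induction A using Multiset.induction with
  | empty => exact ⟨1, one_pos, by simp⟩
  | cons a A ih =>
    obtain ⟨r, hr, h⟩ := ih
    set y := s * (c - a) with hy
    have hpos : 0 < √(1 + y ^ 2) := by positivity
    refine ⟨√(1 + y ^ 2) * r, by positivity, ?_⟩
    have key : (1 - Complex.I * (y : ℂ)) =
        (√(1 + y ^ 2) : ℝ) * Complex.exp (-Complex.I * (Real.arctan y : ℝ)) := by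
      rw [show -Complex.I * (Real.arctan y : ℂ) = (-Real.arctan y : ℝ) * Complex.I by
        push_cast; ring, Complex.exp_mul_I, ← Complex.ofReal_cos, ← Complex.ofReal_sin,
        Real.cos_neg, Real.sin_neg, Real.cos_arctan, Real.sin_arctan]
      have : ((√(1 + y ^ 2) : ℝ) : ℂ) ≠ 0 := by exact_mod_cast hpos.ne'
      push_cast
      field_simp
      ring
    rw [Multiset.map_cons, Multiset.prod_cons, Multiset.map_cons, Multiset.sum_cons, h, ← hy, key,
      Complex.ofReal_add, mul_add, Complex.exp_add]
    push_cast
    ring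

theorem tendsto_multiset_sum_arctan (A : Multiset ℝ) (c : ℝ) (hc : c ∉ A) :
    Filter.Tendsto (fun s : ℝ => (A.map fun a => Real.arctan (s * (c - a))).sum) Filter.atTop
      (nhds (Real.pi / 2 * (Multiset.card A - 2 * A.countP (c < ·)))) := by
  induction A using Multiset.induction with
  | empty => simp
  | cons a A ih =>
    simp only [Multiset.mem_cons, not_or] at hc
    simp only [Multiset.map_cons, Multiset.sum_cons, Multiset.card_cons, Multiset.countP_cons]
    have h1 : Filter.Tendsto (fun s : ℝ => Real.arctan (s * (c - a))) Filter.atTop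
        (nhds (Real.pi / 2 * (1 - 2 * if c < a then 1 else 0))) := by
      split_ifs with h
      · have := (Real.tendsto_arctan_atBot.mono_right nhdsWithin_le_nhds).comp
          (Filter.tendsto_id.atTop_mul_const_of_neg (sub_neg.2 h))
        convert this using 2 <;> norm_num [Function.comp_def]
      · have := (Real.tendsto_arctan_atTop.mono_right nhdsWithin_le_nhds).comp
          (Filter.tendsto_id.atTop_mul_const (sub_pos.2 (lt_of_le_of_ne (not_lt.1 h) (Ne.symm hc.1))))
        convert this using 2 <;> norm_num [Function.comp_def]
    convert h1.add (ih hc.2) using 2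
    push_cast
    ring

theorem abs_lt_pi_div_two_of_cos_pos {φ : ℝ → ℝ} (hφ : Continuous φ) (h0 : φ 0 = 0)
    (hcos : ∀ s, 0 < s → 0 < Real.cos (φ s)) {s : ℝ} (hs : 0 ≤ s) : |φ s| < Real.pi / 2 := by
  by_contra! h
  obtain ⟨t, ht, ht'⟩ := intermediate_value_Icc hs hφ.abs.continuousOn
    (show Real.pi / 2 ∈ Set.Icc |φ 0| |φ s| from ⟨by rw [h0, abs_zero]; positivity, h⟩)
  simp only at ht'
  have htpos : 0 < t := lt_of_le_of_ne ht.1 fun h => by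
    rw [← h, h0, abs_zero] at ht'
    linarith [Real.pi_pos]
  have := hcos t htpos
  rw [← Real.cos_abs, ht', Real.cos_pi_div_two] at this
  exact lt_irrefl _ this

theorem countP_lt_bounds_of_notMem {A B : Multiset ℝ} (hcard : Multiset.card A = Multiset.card B + 1)
    (H : ∀ z : ℂ, 0 < z.im →
      0 < ((A.map fun a : ℝ => z - (a : ℂ)).prod / (B.map fun b : ℝ => z - (b : ℂ)).prod).im)
    {c : ℝ} (hA : c ∉ A) (hB : c ∉ B) :
    B.countP (c < ·) ≤ A.countP (c < ·) ∧ A.countP (c < ·) ≤ B.countP (c < ·) + 1 := by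
  set φ : ℝ → ℝ := fun s => (A.map fun a => Real.arctan (s * (c - a))).sum -
    (B.map fun b => Real.arctan (s * (c - b))).sum with hφ
  have hcont : Continuous φ := by
    refine Continuous.sub ?_ ?_ <;>
    exact continuous_multiset_sum _ fun a _ => by fun_prop
  have h0 : φ 0 = 0 := by simp [hφ]
  have hcos : ∀ s, 0 < s → 0 < Real.cos (φ s) := by
    intro s hs
    obtain ⟨r, hr, hr'⟩ := exists_multiset_prod_eq_mul_exp_arctan A c s
    obtain ⟨t, ht, ht'⟩ := exists_multiset_prod_eq_mul_exp_arctan B c s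
    set z : ℂ := ⟨c, s⁻¹⟩ with hz
    have hsc : (s : ℂ) ≠ 0 := by exact_mod_cast hs.ne'
    have hz' : z = c + (s : ℂ)⁻¹ * Complex.I := by
      apply Complex.ext <;> simp [hz, ← Complex.ofReal_inv]
    have key : ∀ M : Multiset ℝ, (M.map fun a => (1 - Complex.I * (s * (c - a) : ℝ))).prod =
        (-Complex.I * s) ^ Multiset.card M * (M.map fun a : ℝ => z - (a : ℂ)).prod := by
      intro M
      rw [← Multiset.card_map (fun a : ℝ => z - (a : ℂ)) M, ← Multiset.prod_replicate,
        ← Multiset.map_const', Multiset.map_map, ← Multiset.prod_map_mul]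
      refine congrArg _ (Multiset.map_congr rfl fun a _ => ?_)
      rw [hz']
      push_cast
      simp only [Function.comp]
      field_simp
      linear_combination Complex.I_sq
    have hw := H z (by simpa [hz] using hs)
    rw [key A] at hr'
    rw [key B] at ht'
    set w := (A.map fun a : ℝ => z - (a : ℂ)).prod / (B.map fun b : ℝ => z - (b : ℂ)).prod with hw'
    have hI : (-Complex.I * (s : ℂ)) ≠ 0 := by simp [hsc]
    have e : -Complex.I * s * w = (r / t : ℝ) * Complex.exp (-(φ s : ℝ) * Complex.I) := by
      have : -Complex.I * s * w = ((-Complex.I * s) ^ Multiset.card A * (A.map fun a : ℝ => z - (a : ℂ)).prod) /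
          ((-Complex.I * s) ^ Multiset.card B * (B.map fun a : ℝ => z - (a : ℂ)).prod) := by
        rw [hcard, hw', pow_succ]
        have := pow_ne_zero (Multiset.card B) hI
        rw [mul_assoc ((-Complex.I * (s : ℂ)) ^ _), mul_div_mul_left _ _ this, mul_div_assoc]
      rw [this, hr', ht', mul_div_mul_comm, ← Complex.exp_sub]
      push_cast [hφ]
      congr 2
      ring
    have e2 := congrArg Complex.re e
    rw [Complex.re_ofReal_mul, ← Complex.ofReal_neg, Complex.exp_ofReal_mul_I_re, Real.cos_neg] at e2
    have e3 : (-Complex.I * s * w).re = s * w.im := by simp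
    rw [e3] at e2
    have : 0 < r / t * Real.cos (φ s) := e2 ▸ mul_pos hs hw
    exact pos_of_mul_pos_right this (by positivity)
  have hlim := (((tendsto_multiset_sum_arctan A c hA).sub (tendsto_multiset_sum_arctan B c hB))).abs
  have hle := le_of_tendsto hlim (Filter.eventually_atTop.2 ⟨0, fun s hs =>
    (abs_lt_pi_div_two_of_cos_pos hcont h0 hcos hs).le⟩)
  rw [hcard, ← mul_sub, abs_mul, abs_of_pos (by positivity : 0 < Real.pi / 2)] at hle
  have h1 := (mul_le_iff_le_one_right (by positivity : 0 < Real.pi / 2)).1 hle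
  rw [abs_le] at h1
  push_cast at h1
  constructor
  · have : ((B.countP (c < ·) : ℕ) : ℝ) ≤ (A.countP (c < ·) : ℕ) := by linarith [h1.2]
    exact_mod_cast this
  · have : ((A.countP (c < ·) : ℕ) : ℝ) ≤ (B.countP (c < ·) + 1 : ℕ) := by push_cast; linarith [h1.1]
    exact_mod_cast this

theorem countP_lt_bounds {A B : Multiset ℝ} (hcard : Multiset.card A = Multiset.card B + 1)
    (H : ∀ z : ℂ, 0 < z.im →
      0 < ((A.map fun a : ℝ => z - (a : ℂ)).prod / (B.map fun b : ℝ => z - (b : ℂ)).prod).im) (c : ℝ) :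
    B.countP (c < ·) ≤ A.countP (c < ·) ∧ A.countP (c < ·) ≤ B.countP (c < ·) + 1 := by
  have hev : ∀ᶠ d in nhdsWithin c (Set.Ioi c), ∀ a ∈ (A + B).toFinset, d ≠ a ∧ (d < a ↔ c < a) := by
    rw [Filter.eventually_all_finset]
    intro a _
    rcases lt_or_ge c a with h | h
    · filter_upwards [Ioo_mem_nhdsGT h] with d hd
      exact ⟨hd.2.ne, iff_of_true hd.2 h⟩
    · filter_upwards [self_mem_nhdsWithin] with d hd
      have : a < d := lt_of_le_of_lt h hd
      exact ⟨this.ne', iff_of_false this.not_gt h.not_gt⟩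
  obtain ⟨d, hd⟩ := hev.exists
  simp only [Multiset.mem_toFinset, Multiset.mem_add] at hd
  have hA : A.countP (c < ·) = A.countP (d < ·) :=
    Multiset.countP_congr rfl fun a ha => by simpa using (hd a (Or.inl ha)).2.symm
  have hB : B.countP (c < ·) = B.countP (d < ·) :=
    Multiset.countP_congr rfl fun a ha => by simpa using (hd a (Or.inr ha)).2.symm
  rw [hA, hB]
  exact countP_lt_bounds_of_notMem hcard H (fun h => (hd d (Or.inl h)).1 rfl)
    (fun h => (hd d (Or.inr h)).1 rfl)

theorem lt_countP_iff_lt_sort_get (M : Multiset ℝ) (c : ℝ) (i : ℕ)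
    (hi : i < (M.sort (· ≥ ·)).length) :
    i < M.countP (c < ·) ↔ c < (M.sort (· ≥ ·)).get ⟨i, hi⟩ := by
  have hs := M.pairwise_sort (· ≥ ·)
  have hM : M.countP (c < ·) = (M.sort (· ≥ ·)).countP (c < ·) := by
    conv_lhs => rw [← M.sort_eq (· ≥ ·)]
    rfl
  rw [hM]
  generalize M.sort (· ≥ ·) = l at hs hi
  induction l generalizing i with
  | nil => simp at hi
  | cons x l ih =>
    rw [List.pairwise_cons] at hs
    by_cases hx : c < x
    · cases i with
      | zero => simp [hx]
      | succ i =>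
        have := ih i hs.2 (by simpa using hi)
        simpa [hx] using this
    · have h0 : ∀ y ∈ x :: l, ¬ c < y := by
        intro y hy
        rcases List.mem_cons.1 hy with rfl | hy
        · exact hx
        · exact fun h => hx (h.trans_le (hs.1 y hy))
      have : (x :: l).countP (c < ·) = 0 := by
        rw [List.countP_eq_zero]
        simpa using h0
      rw [this]
      simpa using h0 _ (List.get_mem _ ⟨i, hi⟩)

theorem fKpq_monic_and_natDegree (p q : ℕ) : (fKpq p q).Monic ∧ (fKpq p q).natDegree = p + q := by
  have hX : (X + 1 : ℝ[X]).Monic := monic_X_add_C 1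
  have hXd : (X + 1 : ℝ[X]).natDegree = 1 := natDegree_X_add_C 1
  have h0 : ((X + 1 : ℝ[X]) ^ (p + q)).Monic := hX.pow _
  have h0d : ((X + 1 : ℝ[X]) ^ (p + q)).natDegree = p + q := by simp [hX.natDegree_pow, hXd]
  have h0d' : ((X + 1 : ℝ[X]) ^ (p + q)).degree = (p + q : ℕ) := by
    rw [degree_eq_natDegree h0.ne_zero, h0d]
  have hlt : (∑ i ∈ Finset.range (min p q),
      C ((4 : ℝ) ^ (i + 1) * p.choose (i + 1) * q.choose (i + 1)) * X ^ (i + 1) *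
        (X + 1) ^ (p + q - 2 * (i + 1))).degree < ((X + 1 : ℝ[X]) ^ (p + q)).degree := by
    rw [h0d']
    refine (degree_sum_le _ _).trans_lt ((Finset.sup_lt_iff (WithBot.bot_lt_coe _)).2 ?_)
    intro i hi
    simp only [Finset.mem_range] at hi
    refine degree_le_natDegree.trans_lt ?_
    refine Nat.cast_lt.2 (lt_of_le_of_lt (b := i + 1 + (p + q - 2 * (i + 1))) ?_ (by omega))
    refine natDegree_mul_le_of_le (natDegree_C_mul_X_pow_le _ _) ?_
    rw [hX.natDegree_pow, hXd, mul_one]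
  have : fKpq p q = (X + 1) ^ (p + q) + ∑ i ∈ Finset.range (min p q),
      C ((4 : ℝ) ^ (i + 1) * p.choose (i + 1) * q.choose (i + 1)) * X ^ (i + 1) *
        (X + 1) ^ (p + q - 2 * (i + 1)) := by
    rw [fKpq, Finset.sum_range_succ', add_comm]
    simp
  rw [this]
  exact ⟨h0.add_of_left hlt, (natDegree_add_eq_left_of_degree_lt hlt).trans h0d⟩

theorem fKpq_eval_pos (p q : ℕ) {x : ℝ} (hx : 0 ≤ x) : 0 < (fKpq p q).eval x := by
  rw [fKpq, eval_finsetSum]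
  refine Finset.sum_pos' (fun i _ => ?_) ⟨0, by simp, ?_⟩
  · simp only [eval_mul, eval_C, eval_pow, eval_X, eval_add, eval_one]
    positivity
  · simp only [eval_mul, eval_C, eval_pow, eval_X, eval_add, eval_one]
    simp
    positivity

theorem replicate_le_roots_fKpq (p q : ℕ) :
    Multiset.replicate (q - p) (-1) ≤ (fKpq p q).roots := by
  have hdvd : (X + 1 : ℝ[X]) ^ (q - p) ∣ fKpq p q := by
    refine Finset.dvd_sum fun i hi => Dvd.dvd.mul_left (pow_dvd_pow _ ?_) _
    simp only [Finset.mem_range] at hi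
    omega
  have := roots.le_of_dvd (fKpq_monic_and_natDegree p q).1.ne_zero hdvd
  rwa [roots_pow, show (X + 1 : ℝ[X]) = X - C (-1) by simp, roots_X_sub_C,
    Multiset.nsmul_singleton] at this

theorem im_mul_one_sub_div_sub (z : ℂ) (b : ℝ) (hz : 0 < z.im) :
    (z * (1 - z) * (1 / (z - b))).im = -z.im + -(b * (1 - b)) * (z.im / Complex.normSq (z - b)) := by
  have hne : z - b ≠ 0 := fun h => by simpa [hz.ne'] using congrArg Complex.im h
  have : z * (1 - z) * (1 / (z - b)) = 1 - z - b + (b * (1 - b) : ℝ) * (z - b)⁻¹ := by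
    field_simp
    push_cast
    ring
  rw [this, Complex.add_im, Complex.im_ofReal_mul, Complex.inv_im]
  simp
  ring

theorem neg_card_mul_im_le (z : ℂ) (hz : 0 < z.im) (B : Multiset ℝ) (hB : ∀ b ∈ B, b < 0) :
    -(Multiset.card B * z.im) ≤ (z * (1 - z) * (B.map fun b : ℝ => 1 / (z - (b : ℂ))).sum).im := by
  induction B using Multiset.induction with
  | empty => simp
  | cons b B ih =>
    have hb : b < 0 := hB b (Multiset.mem_cons_self b B)
    have := ih fun c hc => hB c (Multiset.mem_cons_of_mem hc)
    rw [Multiset.map_cons, Multiset.sum_cons, mul_add, Complex.add_im, im_mul_one_sub_div_sub z b hz,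
      Multiset.card_cons]
    have h1 : 0 ≤ -(b * (1 - b)) * (z.im / Complex.normSq (z - b)) :=
      mul_nonneg (by nlinarith) (div_nonneg hz.le (Complex.normSq_nonneg _))
    push_cast
    linarith

theorem im_aeval_fKpq_succ_div_pos (p q : ℕ) (hs : (fKpq p q).Splits) {z : ℂ} (hz : 0 < z.im) :
    0 < (aeval z (fKpq p (q + 1)) / aeval z (fKpq p q)).im := by
  obtain ⟨hm, hd⟩ := fKpq_monic_and_natDegree p q
  set f := fKpq p q with hf
  obtain ⟨B, hB⟩ := Multiset.le_iff_exists_add.1 (replicate_le_roots_fKpq p q)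
  have hcard : (q - p) + Multiset.card B = p + q := by
    rw [← hd, hs.natDegree_eq_card_roots, hB, Multiset.card_add, Multiset.card_replicate]
  have hBneg : ∀ b ∈ B, b < 0 := by
    intro b hb
    by_contra! h
    have : b ∈ f.roots := by
      rw [hB]
      exact Multiset.mem_add.2 (Or.inr hb)
    exact (fKpq_eval_pos p q h).ne' ((mem_roots hm.ne_zero).1 this)
  have hev : ∀ g : ℝ[X], eval z (g.map Complex.ofRealHom) = aeval z g := fun g =>
    eval_map_algebraMap g z
  have hroots : (f.map Complex.ofRealHom).roots = f.roots.map Complex.ofRealHom := hs.roots_map _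
  have hz1 : z + 1 ≠ 0 := fun h => by simpa [hz.ne'] using congrArg Complex.im h
  have hfz : aeval z f ≠ 0 := by
    intro h
    obtain ⟨x, hx⟩ := hs.mem_range_of_isRoot hm.ne_zero (i := Complex.ofRealHom) (x := z)
      (by rw [IsRoot, hev, h])
    rw [← hx] at hz
    simp at hz
  have hder : aeval z (derivative f) = aeval z f *
      ((q - p : ℕ) * (1 / (z + 1)) + (B.map fun b : ℝ => 1 / (z - (b : ℂ))).sum) := by
    have := (hs.map Complex.ofRealHom).eval_derivative_eq_eval_mul_sum (x := z) (by rwa [hev])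
    rw [derivative_map, hev, hev, hroots, hB] at this
    rw [this]
    simp [Multiset.map_map]
  set S := (B.map fun b : ℝ => 1 / (z - (b : ℂ))).sum with hS
  have hrec := congrArg (aeval z) (fKpq_derivative_recurrence p q)
  simp only [map_mul, map_add, map_sub, map_one, aeval_X, aeval_C, ← hf, hder] at hrec
  have hkey : ((q + 1 : ℝ) : ℂ) * (aeval z (fKpq p (q + 1)) / aeval z f) =
      z * (1 - z) * S + (q - p : ℕ) * (z * (1 - z) * (1 / (z - (-1 : ℝ)))) + (q + 1 : ℝ) * (z + 1) +
        (p + q : ℝ) * z + (2 * (p - q) : ℝ) * (1 - (z - (-1 : ℝ))⁻¹) := by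
    have h1 : z - (-1 : ℝ) ≠ 0 := by simpa using hz1
    simp only [Complex.coe_algebraMap] at hrec
    push_cast at hrec h1 ⊢
    field_simp at hrec ⊢
    linear_combination hrec
  have him := congrArg Complex.im hkey
  have hk : ((q - p : ℕ) : ℂ) = ((q - p : ℕ) : ℝ) := by simp
  rw [hk] at him
  simp only [Complex.add_im, Complex.im_ofReal_mul, im_mul_one_sub_div_sub z _ hz, Complex.sub_im,
    Complex.inv_im, Complex.one_im, Complex.ofReal_im] at him
  have h1 := neg_card_mul_im_le z hz B hBneg
  rw [← hS] at h1
  set N := z.im / Complex.normSq (z - (-1 : ℝ)) with hN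
  have hN0 : 0 ≤ N := div_nonneg hz.le (Complex.normSq_nonneg _)
  have hcard' : (((q - p : ℕ) : ℝ) + Multiset.card B) = p + q := by exact_mod_cast hcard
  have hqp : (q : ℝ) - p ≤ (q - p : ℕ) := by
    have : q ≤ (q - p) + p := by omega
    have : (q : ℝ) ≤ (q - p : ℕ) + p := by exact_mod_cast this
    linarith
  have hpos : 0 < (q + 1 : ℝ) * (aeval z (fKpq p (q + 1)) / aeval z f).im := by
    rw [him]
    have e1 := mul_nonneg (sub_nonneg.2 hqp) hN0
    have e2 : (q + 1 : ℝ) * z.im > 0 := by positivity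
    have e3 := congrArg (· * z.im) hcard'
    have e4 : (-z.im - 0) / Complex.normSq (z - (-1 : ℝ)) = - N := by rw [hN]; ring
    simp only [sub_zero, zero_sub] at e3 e4 ⊢
    ring_nf at *
    nlinarith
  exact pos_of_mul_pos_right hpos (by positivity)

theorem fKpq_splits (p q : ℕ) : (fKpq p q).Splits := by
  induction q with
  | zero =>
    rw [fKpq_zero_right]
    exact (Splits.X_add_C 1).pow p
  | succ q ih =>
    refine Splits.of_splits_map Complex.ofRealHom (IsAlgClosed.splits _) fun z hz => ?_
    have hz0 : aeval z (fKpq p (q + 1)) = 0 := by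
      rw [← eval_map_algebraMap]
      exact (mem_roots'.1 hz).2
    rcases lt_trichotomy z.im 0 with h | h | h
    · have := im_aeval_fKpq_succ_div_pos p q ih (z := starRingEnd ℂ z) (by simpa using h)
      rw [aeval_conj, hz0] at this
      simp at this
    · exact ⟨z.re, by apply Complex.ext <;> simp [h]⟩
    · have := im_aeval_fKpq_succ_div_pos p q ih h
      rw [hz0] at this
      simp at this

theorem countP_lt_roots_fKpq (p q : ℕ) (c : ℝ) :
    (fKpq p q).roots.countP (c < ·) ≤ (fKpq p (q + 1)).roots.countP (c < ·) ∧
      (fKpq p (q + 1)).roots.countP (c < ·) ≤ (fKpq p q).roots.countP (c < ·) + 1 := by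
  have hprod : ∀ (n : ℕ) (z : ℂ), ((fKpq p n).roots.map fun a : ℝ => z - (a : ℂ)).prod =
      aeval z (fKpq p n) := by
    intro n z
    have hm := (fKpq_monic_and_natDegree p n).1
    rw [((fKpq_splits p n).map _).aeval_eq_prod_aroots_of_monic hm, aroots,
      (fKpq_splits p n).roots_map, Multiset.map_map]
    rfl
  refine countP_lt_bounds ?_ (fun z hz => ?_) c
  · rw [← (fKpq_splits p q).natDegree_eq_card_roots, ← (fKpq_splits p _).natDegree_eq_card_roots,
      (fKpq_monic_and_natDegree p _).2, (fKpq_monic_and_natDegree p _).2, add_assoc]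
  · rw [hprod, hprod]
    exact im_aeval_fKpq_succ_div_pos p q (fKpq_splits p q) hz

/-- `f_{p,q}` and `f_{p,q+1}` are real-rooted and `f_{p,q}` interlaces `f_{p,q+1}`:
listing the roots in weakly decreasing order as `a₁ ≥ a₂ ≥ ⋯` (for `f_{p,q+1}`) and
`b₁ ≥ b₂ ≥ ⋯` (for `f_{p,q}`), one has `a₁ ≥ b₁ ≥ a₂ ≥ b₂ ≥ ⋯`. -/
theorem stmt12 (p q : ℕ) (hp : 0 < p) (hq : 0 < q) :
    (Multiset.card (fKpq p q).roots = (fKpq p q).natDegree) ∧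
    (Multiset.card (fKpq p (q + 1)).roots = (fKpq p (q + 1)).natDegree) ∧
    (∀ i (hB : i < ((fKpq p q).roots.sort (· ≥ ·)).length)
        (hA : i < ((fKpq p (q + 1)).roots.sort (· ≥ ·)).length),
        ((fKpq p q).roots.sort (· ≥ ·)).get ⟨i, hB⟩ ≤
          ((fKpq p (q + 1)).roots.sort (· ≥ ·)).get ⟨i, hA⟩) ∧
    (∀ i (hA : i + 1 < ((fKpq p (q + 1)).roots.sort (· ≥ ·)).length)
        (hB : i < ((fKpq p q).roots.sort (· ≥ ·)).length),
        ((fKpq p (q + 1)).roots.sort (· ≥ ·)).get ⟨i + 1, hA⟩ ≤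
          ((fKpq p q).roots.sort (· ≥ ·)).get ⟨i, hB⟩) := by
  refine ⟨(fKpq_splits p q).natDegree_eq_card_roots.symm,
    (fKpq_splits p _).natDegree_eq_card_roots.symm, fun i hB hA => ?_, fun i hA hB => ?_⟩
  · by_contra! h
    rw [← lt_countP_iff_lt_sort_get] at h
    exact lt_irrefl _ ((lt_countP_iff_lt_sort_get _ _ i hA).1
      (h.trans_le (countP_lt_roots_fKpq p q _).1))
  · by_contra! h
    rw [← lt_countP_iff_lt_sort_get] at h
    exact lt_irrefl _ ((lt_countP_iff_lt_sort_get _ _ i hB).1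
      (Nat.lt_of_succ_lt_succ (h.trans_le (countP_lt_roots_fKpq p q _).2)))
end

section
/- Let G be any simple graph and m_k(G) the number of k-matchings of G. Then the matching generating polynomial M_G(x) = ∑_{k≥0} m_k(G) x^k has only real roots, all of which are nonpositive. -/
open Polynomial Finset

/-- The number of `k`-matchings (sets of `k` pairwise disjoint edges) of `G`. -/
noncomputable def matchNum {V : Type*} (G : SimpleGraph V) (k : ℕ) : ℕ :=
  Set.ncard {s : Finset (Sym2 V) | s.card = k ∧ ↑s ⊆ G.edgeSet ∧
    ∀ e ∈ s, ∀ f ∈ s, e ≠ f → ∀ v, ¬(v ∈ e ∧ v ∈ f)}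

open Classical in
/-- The matchings of `G` all of whose edges have both endpoints in `U`. -/
noncomputable def matchingsIn {V : Type*} [Fintype V] (G : SimpleGraph V) (U : Finset V) :
    Finset (Finset (Sym2 V)) :=
  univ.filter fun s => (↑s ⊆ G.edgeSet ∧
    ∀ e ∈ s, ∀ f ∈ s, e ≠ f → ∀ v, ¬(v ∈ e ∧ v ∈ f)) ∧ ∀ e ∈ s, ∀ v ∈ e, v ∈ U

/-- The matching generating function of the subgraph of `G` induced on `U`. -/
noncomputable def matchingSum {V : Type*} [Fintype V] (G : SimpleGraph V) (z : ℂ)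
    (U : Finset V) : ℂ :=
  ∑ s ∈ matchingsIn G U, z ^ s.card

theorem mem_matchingsIn {V : Type*} [Fintype V] {G : SimpleGraph V} {U : Finset V}
    {s : Finset (Sym2 V)} :
    s ∈ matchingsIn G U ↔ (↑s ⊆ G.edgeSet ∧
      ∀ e ∈ s, ∀ f ∈ s, e ≠ f → ∀ v, ¬(v ∈ e ∧ v ∈ f)) ∧ ∀ e ∈ s, ∀ v ∈ e, v ∈ U := by
  simp [matchingsIn]

theorem matchingSum_empty {V : Type*} [Fintype V] (G : SimpleGraph V) (z : ℂ) :
    matchingSum G z ∅ = 1 := by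
  have h : matchingsIn G ∅ = {∅} := by
    ext s
    rw [mem_matchingsIn, Finset.mem_singleton]
    constructor
    · rintro ⟨-, h⟩
      refine Finset.eq_empty_of_forall_notMem fun e he => ?_
      simpa using h e he _ e.out_fst_mem
    · rintro rfl
      simp
  simp [matchingSum, h]

theorem notMem_of_mem_matchingsIn_erase {V : Type*} [Fintype V] [DecidableEq V]
    {G : SimpleGraph V} {U : Finset V} {v : V} {s : Finset (Sym2 V)}
    (hs : s ∈ matchingsIn G (U.erase v)) {e : Sym2 V} (he : e ∈ s) : v ∉ e := fun hv =>
  Finset.notMem_erase v U ((mem_matchingsIn.1 hs).2 e he v hv)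

theorem matchingsIn_mono {V : Type*} [Fintype V] (G : SimpleGraph V) {U W : Finset V}
    (h : U ⊆ W) : matchingsIn G U ⊆ matchingsIn G W := fun _ hs =>
  mem_matchingsIn.2 ⟨(mem_matchingsIn.1 hs).1,
    fun e he v hv => h ((mem_matchingsIn.1 hs).2 e he v hv)⟩

open Classical in
/-- Matchings on `U` either avoid `v` or contain exactly one edge at `v`. -/
theorem matchingsIn_eq_union {V : Type*} [Fintype V] (G : SimpleGraph V) {U : Finset V} {v : V}
    (hv : v ∈ U) :
    matchingsIn G U = matchingsIn G (U.erase v) ∪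
      ((U.erase v).filter (G.Adj v)).biUnion fun u =>
        (matchingsIn G ((U.erase v).erase u)).image (insert s(v, u)) := by
  ext s
  simp only [Finset.mem_union, Finset.mem_biUnion, Finset.mem_image, Finset.mem_filter]
  constructor
  · intro hs
    obtain ⟨⟨hG, hd⟩, hU⟩ := mem_matchingsIn.1 hs
    by_cases hc : ∃ e ∈ s, v ∈ e
    · obtain ⟨e, he, hve⟩ := hc
      obtain ⟨u, rfl⟩ := hve
      have hadj : G.Adj v u := hG he
      refine Or.inr ⟨u, ⟨Finset.mem_erase.2 ⟨hadj.ne', hU _ he u (by simp)⟩, hadj⟩,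
        s.erase s(v, u), mem_matchingsIn.2 ⟨⟨?_, ?_⟩, ?_⟩, Finset.insert_erase he⟩
      · exact fun f hf => hG (Finset.mem_of_mem_erase hf)
      · exact fun f hf g hg => hd f (Finset.mem_of_mem_erase hf) g (Finset.mem_of_mem_erase hg)
      · intro f hf w hw
        obtain ⟨hne, hf⟩ := Finset.mem_erase.1 hf
        have := hd f hf _ he hne w
        simp only [Finset.mem_erase]
        refine ⟨?_, ?_, hU f hf w hw⟩
        · rintro rfl
          exact this ⟨hw, by simp⟩
        · rintro rfl
          exact this ⟨hw, by simp⟩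
    · push Not at hc
      refine Or.inl (mem_matchingsIn.2 ⟨⟨hG, hd⟩, fun e he w hw => ?_⟩)
      refine Finset.mem_erase.2 ⟨?_, hU e he w hw⟩
      rintro rfl
      exact hc e he hw
  · rintro (hs | ⟨u, ⟨hu, hadj⟩, t, ht, rfl⟩)
    · exact matchingsIn_mono G (Finset.erase_subset _ _) hs
    · have hut : ∀ e ∈ t, u ∉ e := fun e he => notMem_of_mem_matchingsIn_erase ht he
      have hvt : ∀ e ∈ t, v ∉ e := fun e he =>
        notMem_of_mem_matchingsIn_erase (matchingsIn_mono G (Finset.erase_subset _ _) ht) he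
      obtain ⟨⟨hG, hd⟩, hU⟩ := mem_matchingsIn.1 ht
      refine mem_matchingsIn.2 ⟨⟨?_, ?_⟩, ?_⟩
      · intro e he
        rcases Finset.mem_insert.1 (Finset.mem_coe.1 he) with rfl | he
        · exact hadj
        · exact hG he
      · intro e he f hf hne w ⟨hwe, hwf⟩
        rcases Finset.mem_insert.1 he with rfl | het <;>
          rcases Finset.mem_insert.1 hf with rfl | hft
        · exact hne rfl
        · rcases Sym2.mem_iff.1 hwe with rfl | rfl
          · exact hvt f hft hwf
          · exact hut f hft hwf
        · rcases Sym2.mem_iff.1 hwf with rfl | rfl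
          · exact hvt e het hwe
          · exact hut e het hwe
        · exact hd e het f hft hne w ⟨hwe, hwf⟩
      · intro e he w hw
        rcases Finset.mem_insert.1 he with rfl | he
        · rcases Sym2.mem_iff.1 hw with rfl | rfl
          · exact hv
          · exact Finset.mem_of_mem_erase hu
        · exact Finset.mem_of_mem_erase (Finset.mem_of_mem_erase (hU e he w hw))

open Classical in
/-- The vertex-deletion recurrence for matching generating functions. -/
theorem matchingSum_eq_add_sum {V : Type*} [Fintype V] (G : SimpleGraph V) (z : ℂ)
    {U : Finset V} {v : V} (hv : v ∈ U) :
    matchingSum G z U = matchingSum G z (U.erase v) +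
      ∑ u ∈ (U.erase v).filter (G.Adj v), z * matchingSum G z ((U.erase v).erase u) := by
  have hvt : ∀ {u t}, t ∈ matchingsIn G ((U.erase v).erase u) → ∀ e ∈ t, v ∉ e :=
    fun ht e he =>
      notMem_of_mem_matchingsIn_erase (matchingsIn_mono G (Finset.erase_subset _ _) ht) he
  have hnot : ∀ {u t}, t ∈ matchingsIn G ((U.erase v).erase u) → ∀ w, s(v, w) ∉ t :=
    fun ht w hw => hvt ht _ hw (by simp)
  rw [matchingSum, matchingsIn_eq_union G hv, Finset.sum_union, Finset.sum_biUnion]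
  · congr 1
    refine Finset.sum_congr rfl fun u _ => ?_
    rw [Finset.sum_image, matchingSum, Finset.mul_sum]
    · refine Finset.sum_congr rfl fun t ht => ?_
      rw [Finset.card_insert_of_notMem (hnot ht u), pow_succ']
    · intro s hs t ht h
      rw [← Finset.erase_insert (hnot hs u), ← Finset.erase_insert (hnot ht u)]
      exact congrArg (fun r => Finset.erase r s(v, u)) h
  · intro u _ w _ huw
    refine Finset.disjoint_left.2 fun s hs ht => huw ?_
    obtain ⟨a, ha, rfl⟩ := Finset.mem_image.1 hs
    obtain ⟨b, hb, hab⟩ := Finset.mem_image.1 ht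
    have : s(v, u) ∈ insert s(v, w) b := hab ▸ Finset.mem_insert_self _ _
    rcases Finset.mem_insert.1 this with h | h
    · exact Sym2.congr_right.1 h
    · exact absurd h (hnot hb u)
  · refine Finset.disjoint_left.2 fun s hs ht => ?_
    obtain ⟨u, -, ht⟩ := Finset.mem_biUnion.1 ht
    obtain ⟨a, -, rfl⟩ := Finset.mem_image.1 ht
    exact notMem_of_mem_matchingsIn_erase hs (Finset.mem_insert_self _ _) (by simp)

theorem Complex.inv_re_pos {q : ℂ} (hq : 0 < q.re) : 0 < (q⁻¹).re := by
  rw [Complex.inv_re]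
  exact div_pos hq (Complex.normSq_pos.2 fun h => by simp [h] at hq)

open Classical in
/-- Deleting a vertex keeps the normalized ratio of matching generating functions in the open
right half-plane. -/
theorem matchingSum_ratio_re_pos {V : Type*} [Fintype V] (G : SimpleGraph V) {w : ℂ}
    (hw : 0 < w.re) (U : Finset V) :
    matchingSum G (w ^ 2) U ≠ 0 ∧ ∀ v ∈ U,
      0 < (matchingSum G (w ^ 2) U / (w * matchingSum G (w ^ 2) (U.erase v))).re := by
  induction U using Finset.strongInduction with
  | H U ih =>
    have hw0 : w ≠ 0 := fun h => by simp [h] at hw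
    have hratio : ∀ v ∈ U,
        0 < (matchingSum G (w ^ 2) U / (w * matchingSum G (w ^ 2) (U.erase v))).re := by
      intro v hv
      obtain ⟨h0, hr⟩ := ih _ (Finset.erase_ssubset hv)
      have key : matchingSum G (w ^ 2) U / (w * matchingSum G (w ^ 2) (U.erase v)) = w⁻¹ +
          ∑ u ∈ (U.erase v).filter (G.Adj v), (matchingSum G (w ^ 2) (U.erase v) /
            (w * matchingSum G (w ^ 2) ((U.erase v).erase u)))⁻¹ := by
        rw [matchingSum_eq_add_sum G _ hv, add_div, Finset.sum_div]
        congr 1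
        · field_simp
        · refine Finset.sum_congr rfl fun u _ => ?_
          rw [inv_div]
          field_simp
      rw [key, Complex.add_re, Complex.re_sum]
      exact add_pos_of_pos_of_nonneg (Complex.inv_re_pos hw) (Finset.sum_nonneg fun u hu =>
        (Complex.inv_re_pos (hr u (Finset.mem_filter.1 hu).1)).le)
    refine ⟨?_, hratio⟩
    rcases U.eq_empty_or_nonempty with rfl | ⟨v, hv⟩
    · simp [matchingSum_empty]
    · intro h
      simpa [h] using hratio v hv

theorem card_le_of_mem_matchingsIn {V : Type*} [Fintype V] {G : SimpleGraph V} {U : Finset V}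
    {s : Finset (Sym2 V)} (hs : s ∈ matchingsIn G U) : s.card ≤ Fintype.card V := by
  refine Finset.card_le_card_of_injOn (t := univ) (fun e => (Quot.out e).1) (by simp) ?_
  intro e he f hf hef
  by_contra hne
  refine (mem_matchingsIn.1 hs).1.2 e he f hf hne _ ⟨e.out_fst_mem, ?_⟩
  rw [show (Quot.out e).1 = (Quot.out f).1 from hef]
  exact f.out_fst_mem

theorem matchNum_eq_card {V : Type*} [Fintype V] (G : SimpleGraph V) (k : ℕ) :
    matchNum G k = ((matchingsIn G univ).filter fun s => s.card = k).card := by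
  rw [matchNum, ← Set.ncard_coe_finset]
  congr 1
  ext s
  simp only [Set.mem_ofPred_eq, Finset.coe_filter, mem_matchingsIn, Finset.mem_univ]
  tauto

theorem eval_matchingPolynomial {V : Type*} [Fintype V] (G : SimpleGraph V) (z : ℂ) :
    ((∑ k ∈ Finset.range (Fintype.card V + 1), C ((matchNum G k : ℝ)) * X ^ k).map
      (algebraMap ℝ ℂ)).eval z = matchingSum G z univ := by
  rw [matchingSum, ← Finset.sum_fiberwise_of_maps_to (g := Finset.card)
    (t := Finset.range (Fintype.card V + 1))
    fun s hs => Finset.mem_range.2 (Nat.lt_succ_of_le (card_le_of_mem_matchingsIn hs)),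
    Polynomial.map_sum, Polynomial.eval_finsetSum]
  refine Finset.sum_congr rfl fun k _ => ?_
  rw [Finset.sum_congr rfl fun s hs => by rw [(Finset.mem_filter.1 hs).2]]
  simp [matchNum_eq_card]

/-- Off the nonpositive real axis, a complex number has a square root in the open right
half-plane. -/
theorem Complex.exists_sq_eq_re_pos {z : ℂ} (hz : z ∈ Complex.slitPlane) :
    ∃ w : ℂ, 0 < w.re ∧ w ^ 2 = z := by
  obtain ⟨w, hw⟩ := IsAlgClosed.exists_pow_nat_eq z two_pos
  rcases lt_trichotomy w.re 0 with h | h | h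
  · exact ⟨-w, by simpa using h, by simpa using hw⟩
  · subst hw
    rw [Complex.mem_slitPlane_iff] at hz
    simp only [pow_two, Complex.mul_re, Complex.mul_im, h] at hz
    rcases hz with hz | hz
    · nlinarith [mul_self_nonneg w.im]
    · simp at hz
  · exact ⟨w, h, hw⟩

/-- Heilmann–Lieb: the matching generating polynomial `∑_k m_k(G) x^k` of a finite
simple graph has only real, nonpositive roots. -/
theorem stmt14 {V : Type*} [Fintype V] (G : SimpleGraph V) :
    ∀ z : ℂ,
      ((∑ k ∈ Finset.range (Fintype.card V + 1), C ((matchNum G k : ℝ)) * X ^ k).map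
        (algebraMap ℝ ℂ)).eval z = 0 →
      z.im = 0 ∧ z.re ≤ 0 := by
  intro z hz
  rw [eval_matchingPolynomial] at hz
  by_contra hcon
  have hslit : z ∈ Complex.slitPlane := by
    rw [Complex.mem_slitPlane_iff]
    by_contra! h
    exact hcon ⟨h.2, h.1⟩
  obtain ⟨w, hw, rfl⟩ := Complex.exists_sq_eq_re_pos hslit
  exact (matchingSum_ratio_re_pos G hw univ).1 hz
end
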